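/- Let q belong to the Schwartz space 𝒮(ℝ;ℂ) and let λ ∈ ℂ satisfy Im(λ²) ≥ 0. Then I_λ({x₁<x₂<y₁<y₂}) · I_λ({x₁<y₁}) = I_λ({x₁<x₂<y₁<y₂<x₃<y₃}) + 4·I_λ({x₁<x₂<y₁<x₃<y₂<y₃}) + 9·I_λ({x₁<x₂<x₃<y₁<y₂<y₃}) + I_λ({x₁<y₁<x₂<x₃<y₂<y₃}); all integrals converge absolutely. -/

import Mathlib

open MeasureTheory

/-- The elementary kernel `q(y)·conj(q(x))·exp(2iλ²(y−x))`. -/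
noncomputable def ker (q : ℝ → ℂ) (lam : ℂ) (x y : ℝ) : ℂ :=
  q y * (starRingEnd ℂ) (q x) * Complex.exp (2 * Complex.I * lam ^ 2 * ((y - x : ℝ) : ℂ))

/-- Integrand on `ℝ²`, in the variables `p = (x₁, y₁)`. -/
noncomputable def f2 (q : ℝ → ℂ) (lam : ℂ) (p : ℝ × ℝ) : ℂ :=
  ker q lam p.1 p.2

/-- Integrand on `ℝ⁴`, in the variables `p = (x₁, y₁, x₂, y₂)`. -/
noncomputable def f4 (q : ℝ → ℂ) (lam : ℂ) (p : ℝ × ℝ × ℝ × ℝ) : ℂ :=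
  ker q lam p.1 p.2.1 * ker q lam p.2.2.1 p.2.2.2

/-- Integrand on `ℝ⁶`, in the variables `p = (x₁, y₁, x₂, y₂, x₃, y₃)`. -/
noncomputable def f6 (q : ℝ → ℂ) (lam : ℂ) (p : ℝ × ℝ × ℝ × ℝ × ℝ × ℝ) : ℂ :=
  ker q lam p.1 p.2.1 * ker q lam p.2.2.1 p.2.2.2.1 * ker q lam p.2.2.2.2.1 p.2.2.2.2.2

/-- The region `{x₁ < y₁}` of `ℝ²`, in the variables `p = (x₁, y₁)`. -/
def R_XY : Set (ℝ × ℝ) := {p | p.1 < p.2}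

/-- The region `{x₁ < y₁ < x₂ < y₂}` of `ℝ⁴`, in the variables `p = (x₁, y₁, x₂, y₂)`. -/
def R_XYXY : Set (ℝ × ℝ × ℝ × ℝ) :=
  {p | p.1 < p.2.1 ∧ p.2.1 < p.2.2.1 ∧ p.2.2.1 < p.2.2.2}

/-- The region `{x₁ < x₂ < y₁ < y₂}` of `ℝ⁴`, in the variables `p = (x₁, y₁, x₂, y₂)`. -/
def R_XXYY : Set (ℝ × ℝ × ℝ × ℝ) :=
  {p | p.1 < p.2.2.1 ∧ p.2.2.1 < p.2.1 ∧ p.2.1 < p.2.2.2}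

/-- The region `{x₁ < y₁ < x₂ < y₂ < x₃ < y₃}` of `ℝ⁶`,
in the variables `p = (x₁, y₁, x₂, y₂, x₃, y₃)`. -/
def R_XYXYXY : Set (ℝ × ℝ × ℝ × ℝ × ℝ × ℝ) :=
  {p | p.1 < p.2.1 ∧ p.2.1 < p.2.2.1 ∧ p.2.2.1 < p.2.2.2.1 ∧
       p.2.2.2.1 < p.2.2.2.2.1 ∧ p.2.2.2.2.1 < p.2.2.2.2.2}

/-- The region `{x₁ < x₂ < y₁ < y₂ < x₃ < y₃}` of `ℝ⁶`,
in the variables `p = (x₁, y₁, x₂, y₂, x₃, y₃)`. -/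
def R_XXYYXY : Set (ℝ × ℝ × ℝ × ℝ × ℝ × ℝ) :=
  {p | p.1 < p.2.2.1 ∧ p.2.2.1 < p.2.1 ∧ p.2.1 < p.2.2.2.1 ∧
       p.2.2.2.1 < p.2.2.2.2.1 ∧ p.2.2.2.2.1 < p.2.2.2.2.2}

/-- The region `{x₁ < x₂ < y₁ < x₃ < y₂ < y₃}` of `ℝ⁶`,
in the variables `p = (x₁, y₁, x₂, y₂, x₃, y₃)`. -/
def R_XXYXYY : Set (ℝ × ℝ × ℝ × ℝ × ℝ × ℝ) :=
  {p | p.1 < p.2.2.1 ∧ p.2.2.1 < p.2.1 ∧ p.2.1 < p.2.2.2.2.1 ∧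
       p.2.2.2.2.1 < p.2.2.2.1 ∧ p.2.2.2.1 < p.2.2.2.2.2}

/-- The region `{x₁ < y₁ < x₂ < x₃ < y₂ < y₃}` of `ℝ⁶`,
in the variables `p = (x₁, y₁, x₂, y₂, x₃, y₃)`. -/
def R_XYXXYY : Set (ℝ × ℝ × ℝ × ℝ × ℝ × ℝ) :=
  {p | p.1 < p.2.1 ∧ p.2.1 < p.2.2.1 ∧ p.2.2.1 < p.2.2.2.2.1 ∧
       p.2.2.2.2.1 < p.2.2.2.1 ∧ p.2.2.2.1 < p.2.2.2.2.2}

/-- The region `{x₁ < x₂ < x₃ < y₁ < y₂ < y₃}` of `ℝ⁶`,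
in the variables `p = (x₁, y₁, x₂, y₂, x₃, y₃)`. -/
def R_XXXYYY : Set (ℝ × ℝ × ℝ × ℝ × ℝ × ℝ) :=
  {p | p.1 < p.2.2.1 ∧ p.2.2.1 < p.2.2.2.2.1 ∧ p.2.2.2.2.1 < p.2.1 ∧
       p.2.1 < p.2.2.2.1 ∧ p.2.2.2.1 < p.2.2.2.2.2}

theorem ker_eq_mul_exp (q : ℝ → ℂ) (lam : ℂ) (x y : ℝ) :
    ker q lam x y = q y * Complex.exp (2 * Complex.I * lam ^ 2 * y) *
      ((starRingEnd ℂ) (q x) * Complex.exp (-(2 * Complex.I * lam ^ 2 * x))) := by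
  have h : 2 * Complex.I * lam ^ 2 * ((y - x : ℝ) : ℂ)
      = 2 * Complex.I * lam ^ 2 * y + -(2 * Complex.I * lam ^ 2 * x) := by
    push_cast
    ring
  rw [ker, h, Complex.exp_add]
  ring

theorem norm_ker_le (q : ℝ → ℂ) {lam : ℂ} (hlam : 0 ≤ (lam ^ 2).im) {x y : ℝ} (hxy : x < y) :
    ‖ker q lam x y‖ ≤ ‖q x‖ * ‖q y‖ := by
  have hre : (2 * Complex.I * lam ^ 2 * ((y - x : ℝ) : ℂ)).re
      = -(2 * (lam ^ 2).im * (y - x)) := by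
    simp [Complex.mul_re, Complex.mul_im]
  have hexp : ‖Complex.exp (2 * Complex.I * lam ^ 2 * ((y - x : ℝ) : ℂ))‖ ≤ 1 := by
    rw [Complex.norm_exp, hre, Real.exp_le_one_iff]
    have := mul_nonneg hlam (sub_pos.2 hxy).le
    linarith
  rw [ker, norm_mul, norm_mul, RCLike.norm_conj, mul_comm ‖q x‖]
  exact mul_le_of_le_one_right (by positivity) hexp

theorem f6_swap_x₁_x₂ (q : ℝ → ℂ) (lam : ℂ) (a b c d e f : ℝ) :
    f6 q lam (c, b, a, d, e, f) = f6 q lam (a, b, c, d, e, f) := by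
  simp only [f6, ker_eq_mul_exp]
  ring

theorem f6_swap_x₂_x₃ (q : ℝ → ℂ) (lam : ℂ) (a b c d e f : ℝ) :
    f6 q lam (a, b, e, d, c, f) = f6 q lam (a, b, c, d, e, f) := by
  simp only [f6, ker_eq_mul_exp]
  ring

theorem f6_swap_y₁_y₂ (q : ℝ → ℂ) (lam : ℂ) (a b c d e f : ℝ) :
    f6 q lam (a, d, c, b, e, f) = f6 q lam (a, b, c, d, e, f) := by
  simp only [f6, ker_eq_mul_exp]
  ring

theorem f6_swap_y₂_y₃ (q : ℝ → ℂ) (lam : ℂ) (a b c d e f : ℝ) :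
    f6 q lam (a, b, c, f, e, d) = f6 q lam (a, b, c, d, e, f) := by
  simp only [f6, ker_eq_mul_exp]
  ring

theorem continuous_f2 (q : SchwartzMap ℝ ℂ) (lam : ℂ) : Continuous (f2 q lam) := by
  unfold f2 ker
  have := q.continuous
  fun_prop

theorem continuous_f4 (q : SchwartzMap ℝ ℂ) (lam : ℂ) : Continuous (f4 q lam) := by
  unfold f4 ker
  have := q.continuous
  fun_prop

theorem continuous_f6 (q : SchwartzMap ℝ ℂ) (lam : ℂ) : Continuous (f6 q lam) := by
  unfold f6 ker
  have := q.continuous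
  fun_prop

theorem integrableOn_f2 (q : SchwartzMap ℝ ℂ) {lam : ℂ} (hlam : 0 ≤ (lam ^ 2).im)
    {S : Set (ℝ × ℝ)} (hS : MeasurableSet S) (h : ∀ p ∈ S, p.1 < p.2) :
    IntegrableOn (f2 q lam) S := by
  have hq : Integrable (fun x => ‖q x‖) := q.integrable.norm
  refine Integrable.mono' (hq.mul_prod hq).integrableOn
    (continuous_f2 q lam).aestronglyMeasurable
    (ae_restrict_of_forall_mem hS fun p hp => norm_ker_le q hlam (h p hp))

theorem integrableOn_f4 (q : SchwartzMap ℝ ℂ) {lam : ℂ} (hlam : 0 ≤ (lam ^ 2).im)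
    {S : Set (ℝ × ℝ × ℝ × ℝ)} (hS : MeasurableSet S)
    (h : ∀ p ∈ S, p.1 < p.2.1 ∧ p.2.2.1 < p.2.2.2) :
    IntegrableOn (f4 q lam) S := by
  have hq : Integrable (fun x => ‖q x‖) := q.integrable.norm
  refine Integrable.mono' (hq.mul_prod (hq.mul_prod (hq.mul_prod hq))).integrableOn
    (continuous_f4 q lam).aestronglyMeasurable (ae_restrict_of_forall_mem hS fun p hp => ?_)
  obtain ⟨h₁, h₂⟩ := h p hp
  calc ‖f4 q lam p‖ ≤ (‖q p.1‖ * ‖q p.2.1‖) * (‖q p.2.2.1‖ * ‖q p.2.2.2‖) := by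
        rw [f4, norm_mul]
        gcongr
        exacts [norm_ker_le q hlam h₁, norm_ker_le q hlam h₂]
    _ = _ := by ring

theorem integrableOn_f6 (q : SchwartzMap ℝ ℂ) {lam : ℂ} (hlam : 0 ≤ (lam ^ 2).im)
    {S : Set (ℝ × ℝ × ℝ × ℝ × ℝ × ℝ)} (hS : MeasurableSet S)
    (h : ∀ p ∈ S, p.1 < p.2.1 ∧ p.2.2.1 < p.2.2.2.1 ∧ p.2.2.2.2.1 < p.2.2.2.2.2) :
    IntegrableOn (f6 q lam) S := by
  have hq : Integrable (fun x => ‖q x‖) := q.integrable.norm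
  refine Integrable.mono' (hq.mul_prod (hq.mul_prod (hq.mul_prod (hq.mul_prod
      (hq.mul_prod hq))))).integrableOn
    (continuous_f6 q lam).aestronglyMeasurable (ae_restrict_of_forall_mem hS fun p hp => ?_)
  obtain ⟨h₁, h₂, h₃⟩ := h p hp
  calc ‖f6 q lam p‖ ≤ (‖q p.1‖ * ‖q p.2.1‖) * (‖q p.2.2.1‖ * ‖q p.2.2.2.1‖) *
          (‖q p.2.2.2.2.1‖ * ‖q p.2.2.2.2.2‖) := by
        rw [f6, norm_mul, norm_mul]
        gcongr
        exacts [norm_ker_le q hlam h₁, norm_ker_le q hlam h₂, norm_ker_le q hlam h₃]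
    _ = _ := by ring

theorem measurePreserving_id_prod {α β γ : Type*} [MeasureSpace α] [MeasureSpace β]
    [MeasureSpace γ] [SFinite (volume : Measure α)] [SFinite (volume : Measure β)]
    [SFinite (volume : Measure γ)] {f : β → γ} (hf : MeasurePreserving f) :
    MeasurePreserving (fun p : α × β => (p.1, f p.2)) :=
  (MeasurePreserving.id volume).prod hf

section Coordinates

variable {α β γ δ : Type*} [MeasureSpace α] [MeasureSpace β] [MeasureSpace γ] [MeasureSpace δ]
  [SFinite (volume : Measure α)] [SFinite (volume : Measure β)]
  [SFinite (volume : Measure γ)] [SFinite (volume : Measure δ)]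

theorem measurePreserving_swap₁₂ :
    MeasurePreserving (fun p : α × β × γ => (p.2.1, p.1, p.2.2)) :=
  (volume_preserving_prodAssoc (α₁ := β) (β₁ := α) (γ₁ := γ)).comp
    ((Measure.measurePreserving_swap.prod (MeasurePreserving.id volume)).comp
      ((volume_preserving_prodAssoc (α₁ := α) (β₁ := β) (γ₁ := γ)).symm
        MeasurableEquiv.prodAssoc))

theorem measurePreserving_swap₁₃ :
    MeasurePreserving (fun p : α × β × γ × δ => (p.2.2.1, p.2.1, p.1, p.2.2.2)) :=
  measurePreserving_swap₁₂.comp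
    ((measurePreserving_id_prod measurePreserving_swap₁₂).comp measurePreserving_swap₁₂)

theorem measurePreserving_reverse₃ :
    MeasurePreserving (fun p : α × β × γ => (p.2.2, p.2.1, p.1)) :=
  measurePreserving_swap₁₂.comp
    ((measurePreserving_id_prod Measure.measurePreserving_swap).comp measurePreserving_swap₁₂)

end Coordinates

theorem measurePreserving_flatten :
    MeasurePreserving (fun z : (ℝ × ℝ × ℝ × ℝ) × (ℝ × ℝ) =>
      (z.1.1, z.1.2.1, z.1.2.2.1, z.1.2.2.2, z.2.1, z.2.2)) :=
  (measurePreserving_id_prod (measurePreserving_id_prod volume_preserving_prodAssoc)).comp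
    ((measurePreserving_id_prod volume_preserving_prodAssoc).comp volume_preserving_prodAssoc)

theorem isAddHaarMeasure_volume_prod {E F : Type*} [NormedAddCommGroup E] [MeasureSpace E]
    [BorelSpace E] [SecondCountableTopology E] [NormedAddCommGroup F] [MeasureSpace F]
    [BorelSpace F] [SecondCountableTopology F] [(volume : Measure E).IsAddHaarMeasure]
    [(volume : Measure F).IsAddHaarMeasure] [SigmaFinite (volume : Measure E)]
    [SigmaFinite (volume : Measure F)] : (volume : Measure (E × F)).IsAddHaarMeasure :=
  inferInstanceAs ((volume : Measure E).prod volume).IsAddHaarMeasure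

theorem ae_ne_zero_of_isLinearMap {E : Type*} [NormedAddCommGroup E] [NormedSpace ℝ E]
    [MeasurableSpace E] [BorelSpace E] [FiniteDimensional ℝ E] {μ : Measure E}
    [μ.IsAddHaarMeasure] {f : E → ℝ} (hf : IsLinearMap ℝ f) (h : ∃ p, f p ≠ 0) :
    ∀ᵐ p ∂μ, f p ≠ 0 := by
  have hker : LinearMap.ker (hf.mk' f) ≠ ⊤ := by
    intro htop
    obtain ⟨p, hp⟩ := h
    have : p ∈ LinearMap.ker (hf.mk' f) := htop ▸ Submodule.mem_top
    exact hp (by simpa using this)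
  rw [ae_iff]
  convert Measure.addHaar_submodule μ _ hker using 2
  ext p
  simp

theorem MeasureTheory.MeasurePreserving.integral_eq_integral_comp {α β E : Type*}
    [MeasurableSpace α] [MeasurableSpace β] [NormedAddCommGroup E] [NormedSpace ℝ E]
    {μ : Measure α} {ν : Measure β} {g : α → β} (hg : MeasurePreserving g μ ν) {G : β → E}
    (hG : AEStronglyMeasurable G ν) : ∫ y, G y ∂ν = ∫ x, G (g x) ∂μ := by
  rw [← hg.map_eq] at hG ⊢
  exact integral_map hg.measurable.aemeasurable hG

/-- Sorting three coordinates `u`, `v`, `w`, given an integrand supported on `u < v`: the map `s`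
exchanges `u` and `v`, and `t` exchanges `v` and `w`. -/
theorem integral_eq_integral_indicator_sorted {Ω : Type*} [MeasurableSpace Ω] {μ : Measure Ω}
    {u v w : Ω → ℝ} (hu : Measurable u) (hv : Measurable v) (hw : Measurable w)
    {s t : Ω → Ω} (hs : MeasurePreserving s μ μ) (ht : MeasurePreserving t μ μ)
    (hus : ∀ p, u (s p) = v p) (hvs : ∀ p, v (s p) = u p) (hws : ∀ p, w (s p) = w p)
    (hut : ∀ p, u (t p) = u p) (hvt : ∀ p, v (t p) = w p) (hwt : ∀ p, w (t p) = v p)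
    (huw : ∀ᵐ p ∂μ, u p ≠ w p) (hvw : ∀ᵐ p ∂μ, v p ≠ w p)
    {F : Ω → ℂ} (hF : Integrable F μ) (hsupp : ∀ p, ¬ u p < v p → F p = 0) :
    Integrable ({p | u p < v p ∧ v p < w p}.indicator
      fun p => F p + F (t p) + F (t (s p))) μ ∧
    ∫ p, F p ∂μ = ∫ p, {p | u p < v p ∧ v p < w p}.indicator
      (fun p => F p + F (t p) + F (t (s p))) p ∂μ := by
  have hts : MeasurePreserving (fun p => t (s p)) μ μ := ht.comp hs
  have hS : MeasurableSet {p | u p < v p ∧ v p < w p} :=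
    (measurableSet_lt hu hv).inter (measurableSet_lt hv hw)
  have hB : MeasurableSet {p | u p < w p ∧ w p < v p} :=
    (measurableSet_lt hu hw).inter (measurableSet_lt hw hv)
  have hC : MeasurableSet {p | w p < u p ∧ u p < v p} :=
    (measurableSet_lt hw hu).inter (measurableSet_lt hu hv)
  have hFt : Integrable (fun p => F (t p)) μ := ht.integrable_comp_of_integrable hF
  have hFts : Integrable (fun p => F (t (s p))) μ := hts.integrable_comp_of_integrable hF
  refine ⟨((hF.add hFt).add hFts).indicator hS, ?_⟩
  have hsplit : ∫ p, F p ∂μ = ∫ p, ({p | u p < v p ∧ v p < w p}.indicator F p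
      + {p | u p < w p ∧ w p < v p}.indicator F p
      + {p | w p < u p ∧ u p < v p}.indicator F p) ∂μ := by
    refine integral_congr_ae ?_
    filter_upwards [huw, hvw] with p h₁ h₂
    simp only [Set.indicator_apply, Set.mem_ofPred_eq]
    by_cases h : u p < v p
    · rcases lt_or_gt_of_ne h₁ with h₁ | h₁ <;> rcases lt_or_gt_of_ne h₂ with h₂ | h₂ <;>
        simp [h, h₁, h₂, h₁.not_gt, h₂.not_gt]
      exact absurd h (h₂.trans h₁).not_gt
    · simp [hsupp p h]
  have hsum : ∀ p, {p | u p < v p ∧ v p < w p}.indicator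
      (fun p => F p + F (t p) + F (t (s p))) p
      = {p | u p < v p ∧ v p < w p}.indicator F p
        + {p | u p < w p ∧ w p < v p}.indicator F (t p)
        + {p | w p < u p ∧ u p < v p}.indicator F (t (s p)) := by
    intro p
    simp only [Set.indicator_apply, Set.mem_ofPred_eq, hut, hvt, hwt, hus, hvs, hws]
    split_ifs <;> simp
  rw [hsplit, integral_add (f := fun p => {p | u p < v p ∧ v p < w p}.indicator F p
      + {p | u p < w p ∧ w p < v p}.indicator F p)
      ((hF.indicator hS).add (hF.indicator hB)) (hF.indicator hC),
    integral_add (hF.indicator hS) (hF.indicator hB), ht.integral_eq_integral_comp (hF.indicator hB).1,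
    hts.integral_eq_integral_comp (hF.indicator hC).1]
  simp_rw [hsum]
  rw [integral_add, integral_add]
  · exact hF.indicator hS
  · exact ht.integrable_comp_of_integrable (hF.indicator hB)
  · exact (hF.indicator hS).add (ht.integrable_comp_of_integrable (hF.indicator hB))
  · exact hts.integrable_comp_of_integrable (hF.indicator hC)

/-- The region `{x₁ < x₂ < y₁ < y₂} ∩ {x₃ < y₃}` of `ℝ⁶`,
in the variables `p = (x₁, y₁, x₂, y₂, x₃, y₃)`. -/
def R_XXYY_XY : Set (ℝ × ℝ × ℝ × ℝ × ℝ × ℝ) :=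
  {p | (p.1 < p.2.2.1 ∧ p.2.2.1 < p.2.1 ∧ p.2.1 < p.2.2.2.1) ∧ p.2.2.2.2.1 < p.2.2.2.2.2}

theorem measurableSet_R_XXYY_XY : MeasurableSet R_XXYY_XY := by
  unfold R_XXYY_XY
  measurability

theorem setIntegral_f4_mul_setIntegral_f2 (q : SchwartzMap ℝ ℂ) (lam : ℂ) :
    (∫ p in R_XXYY, f4 q lam p) * (∫ p in R_XY, f2 q lam p)
      = ∫ p, R_XXYY_XY.indicator (f6 q lam) p := by
  have h₄ : MeasurableSet R_XXYY := by unfold R_XXYY; measurability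
  have h₂ : MeasurableSet R_XY := by unfold R_XY; measurability
  rw [← setIntegral_prod_mul, ← integral_indicator (h₄.prod h₂),
    measurePreserving_flatten.integral_eq_integral_comp
      ((continuous_f6 q lam).aestronglyMeasurable.indicator measurableSet_R_XXYY_XY)]
  rfl

/-- Pointwise form of the shuffle product of `XXYY` and `XY`: the nine ways to choose `x₃` and `y₃`
in a sorted triple of `x`s and a sorted triple of `y`s, grouped by the resulting word. -/
theorem sum_indicator_orderings (z : ℂ) {a b c d e f : ℝ} (hcb : c ≠ b) (heb : e ≠ b)
    (hed : e ≠ d) (hac : a < c) (hce : c < e) (hbd : b < d)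
    (hdf : d < f) :
    R_XXYY_XY.indicator (fun _ => z) (a, b, c, d, e, f)
      + R_XXYY_XY.indicator (fun _ => z) (a, b, e, d, c, f)
      + R_XXYY_XY.indicator (fun _ => z) (c, b, e, d, a, f)
      + R_XXYY_XY.indicator (fun _ => z) (a, b, c, f, e, d)
      + R_XXYY_XY.indicator (fun _ => z) (a, b, e, f, c, d)
      + R_XXYY_XY.indicator (fun _ => z) (c, b, e, f, a, d)
      + R_XXYY_XY.indicator (fun _ => z) (a, d, c, f, e, b)
      + R_XXYY_XY.indicator (fun _ => z) (a, d, e, f, c, b)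
      + R_XXYY_XY.indicator (fun _ => z) (c, d, e, f, a, b)
    = R_XXYYXY.indicator (fun _ => z) (a, b, c, d, e, f)
      + 4 * R_XXYXYY.indicator (fun _ => z) (a, b, c, d, e, f)
      + 9 * R_XXXYYY.indicator (fun _ => z) (a, b, c, d, e, f)
      + R_XYXXYY.indicator (fun _ => z) (a, b, c, d, e, f) := by
  simp only [Set.indicator_apply, R_XXYY_XY, R_XXYYXY, R_XXYXYY, R_XXXYYY, R_XYXXYY,
    Set.mem_ofPred_eq]
  have e₂ : (a < e ∧ e < b ∧ b < d) ∧ c < f ↔ e < b := by grind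
  have e₃ : (c < e ∧ e < b ∧ b < d) ∧ a < f ↔ e < b := by grind
  have e₄ : (a < c ∧ c < b ∧ b < f) ∧ e < d ↔ c < b ∧ e < d := by grind
  have e₅ : (a < e ∧ e < b ∧ b < f) ∧ c < d ↔ e < b := by grind
  have e₆ : (c < e ∧ e < b ∧ b < f) ∧ a < d ↔ e < b := by grind
  have e₇ : (a < c ∧ c < d ∧ d < f) ∧ e < b ↔ e < b := by grind
  have e₈ : (a < e ∧ e < d ∧ d < f) ∧ c < b ↔ c < b ∧ e < d := by grind
  have e₉ : (c < e ∧ e < d ∧ d < f) ∧ a < b ↔ e < d ∧ a < b := by grind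
  simp only [e₂, e₃, e₄, e₅, e₆, e₇, e₈, e₉]
  simp only [hac, hce, hbd, hdf, true_and, and_true]
  have hab : c < b → a < b := hac.trans
  have hef : e < d → e < f := fun h => h.trans hdf
  rcases lt_or_gt_of_ne hcb with h₁ | h₁ <;> rcases lt_or_gt_of_ne heb with h₂ | h₂ <;>
    rcases lt_or_gt_of_ne hed with h₃ | h₃ <;>
    first
    | order
    | simp [h₁, h₂, h₃, h₁.not_gt, h₂.not_gt, h₃.not_gt, hab, hef]; done
    | simp [h₁, h₂, h₃, h₁.not_gt, h₂.not_gt, h₃.not_gt, hab, hef]; ring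

theorem integral_indicator_R_XXYY_XY (q : SchwartzMap ℝ ℂ) {lam : ℂ} (hlam : 0 ≤ (lam ^ 2).im) :
    ∫ p, R_XXYY_XY.indicator (f6 q lam) p
      = ∫ p, (R_XXYYXY.indicator (f6 q lam) p + 4 * R_XXYXYY.indicator (f6 q lam) p
        + 9 * R_XXXYYY.indicator (f6 q lam) p + R_XYXXYY.indicator (f6 q lam) p) := by
  have hF_int : Integrable (R_XXYY_XY.indicator (f6 q lam)) := by
    refine (integrableOn_f6 q hlam measurableSet_R_XXYY_XY ?_).integrable_indicator
      measurableSet_R_XXYY_XY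
    rintro p ⟨⟨h₁, h₂, h₃⟩, h₄⟩
    exact ⟨h₁.trans h₂, h₂.trans h₃, h₄⟩
  have : (volume : Measure (ℝ × ℝ)).IsAddHaarMeasure := isAddHaarMeasure_volume_prod
  have : (volume : Measure (ℝ × ℝ × ℝ)).IsAddHaarMeasure := isAddHaarMeasure_volume_prod
  have : (volume : Measure (ℝ × ℝ × ℝ × ℝ)).IsAddHaarMeasure := isAddHaarMeasure_volume_prod
  have : (volume : Measure (ℝ × ℝ × ℝ × ℝ × ℝ)).IsAddHaarMeasure := isAddHaarMeasure_volume_prod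
  have : (volume : Measure (ℝ × ℝ × ℝ × ℝ × ℝ × ℝ)).IsAddHaarMeasure :=
    isAddHaarMeasure_volume_prod
  have ne {u v : ℝ × ℝ × ℝ × ℝ × ℝ × ℝ → ℝ} (huv : IsLinearMap ℝ fun p => u p - v p)
      (h : ∃ p, u p - v p ≠ 0) : ∀ᵐ p, u p ≠ v p := by
    have := ae_ne_zero_of_isLinearMap (μ := volume) huv h
    filter_upwards [this] with p hp using sub_ne_zero.1 hp
  have x₁₃ : ∀ᵐ p : ℝ × ℝ × ℝ × ℝ × ℝ × ℝ, p.1 ≠ p.2.2.2.2.1 :=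
    ne ⟨by intros; simp; ring, by intros; simp; ring⟩ ⟨(1, 0, 0, 0, 0, 0), by simp⟩
  have x₂₃ : ∀ᵐ p : ℝ × ℝ × ℝ × ℝ × ℝ × ℝ, p.2.2.1 ≠ p.2.2.2.2.1 :=
    ne ⟨by intros; simp; ring, by intros; simp; ring⟩ ⟨(0, 0, 1, 0, 0, 0), by simp⟩
  have y₁₃ : ∀ᵐ p : ℝ × ℝ × ℝ × ℝ × ℝ × ℝ, p.2.1 ≠ p.2.2.2.2.2 :=
    ne ⟨by intros; simp; ring, by intros; simp; ring⟩ ⟨(0, 1, 0, 0, 0, 0), by simp⟩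
  have y₂₃ : ∀ᵐ p : ℝ × ℝ × ℝ × ℝ × ℝ × ℝ, p.2.2.2.1 ≠ p.2.2.2.2.2 :=
    ne ⟨by intros; simp; ring, by intros; simp; ring⟩ ⟨(0, 0, 0, 1, 0, 0), by simp⟩
  have x₂y₁ : ∀ᵐ p : ℝ × ℝ × ℝ × ℝ × ℝ × ℝ, p.2.2.1 ≠ p.2.1 :=
    ne ⟨by intros; simp; ring, by intros; simp; ring⟩ ⟨(0, 0, 1, 0, 0, 0), by simp⟩
  have x₃y₁ : ∀ᵐ p : ℝ × ℝ × ℝ × ℝ × ℝ × ℝ, p.2.2.2.2.1 ≠ p.2.1 :=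
    ne ⟨by intros; simp; ring, by intros; simp; ring⟩ ⟨(0, 0, 0, 0, 1, 0), by simp⟩
  have x₃y₂ : ∀ᵐ p : ℝ × ℝ × ℝ × ℝ × ℝ × ℝ, p.2.2.2.2.1 ≠ p.2.2.2.1 :=
    ne ⟨by intros; simp; ring, by intros; simp; ring⟩ ⟨(0, 0, 0, 0, 1, 0), by simp⟩
  obtain ⟨hG_int, hx⟩ := integral_eq_integral_indicator_sorted
    (μ := (volume : Measure (ℝ × ℝ × ℝ × ℝ × ℝ × ℝ)))
    (u := fun p => p.1) (v := fun p => p.2.2.1) (w := fun p => p.2.2.2.2.1)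
    (by fun_prop) (by fun_prop) (by fun_prop) measurePreserving_swap₁₃
    (measurePreserving_id_prod (measurePreserving_id_prod measurePreserving_swap₁₃))
    (fun _ => rfl) (fun _ => rfl) (fun _ => rfl) (fun _ => rfl) (fun _ => rfl) (fun _ => rfl)
    x₁₃ x₂₃ hF_int (fun p hp => Set.indicator_of_notMem (fun h => hp h.1.1) _)
  obtain ⟨-, hy⟩ := integral_eq_integral_indicator_sorted
    (μ := (volume : Measure (ℝ × ℝ × ℝ × ℝ × ℝ × ℝ)))
    (u := fun p => p.2.1) (v := fun p => p.2.2.2.1) (w := fun p => p.2.2.2.2.2)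
    (by fun_prop) (by fun_prop) (by fun_prop)
    (measurePreserving_id_prod measurePreserving_swap₁₃)
    (measurePreserving_id_prod (measurePreserving_id_prod
      (measurePreserving_id_prod measurePreserving_reverse₃)))
    (fun _ => rfl) (fun _ => rfl) (fun _ => rfl) (fun _ => rfl) (fun _ => rfl) (fun _ => rfl)
    y₁₃ y₂₃ hG_int (fun p hp => by
      refine Set.indicator_apply_eq_zero.2 fun _ => ?_
      rw [Set.indicator_of_notMem (fun h => hp h.1.2.2),
        Set.indicator_of_notMem (fun h => hp h.1.2.2),
        Set.indicator_of_notMem (fun h => hp h.1.2.2)]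
      simp)
  rw [hx, hy]
  refine integral_congr_ae ?_
  filter_upwards [x₂y₁, x₃y₁, x₃y₂] with ⟨a, b, c, d, e, f⟩ h₂ h₃ h₅
  by_cases hs : (a < c ∧ c < e) ∧ b < d ∧ d < f
  · obtain ⟨⟨hac, hce⟩, hbd, hdf⟩ := hs
    have key := sum_indicator_orderings (f6 q lam (a, b, c, d, e, f)) h₂ h₃ h₅ hac hce hbd hdf
    classical
    simp only [Set.indicator_apply, Set.mem_ofPred_eq, hac, hce, hbd, hdf, and_self, if_true,
      f6_swap_x₁_x₂, f6_swap_x₂_x₃, f6_swap_y₁_y₂, f6_swap_y₂_y₃] at key ⊢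
    simpa only [add_assoc] using key
  · rw [Set.indicator_of_notMem (s := R_XXYYXY) (by grind [R_XXYYXY]),
      Set.indicator_of_notMem (s := R_XXYXYY) (by grind [R_XXYXYY]),
      Set.indicator_of_notMem (s := R_XXXYYY) (by grind [R_XXXYYY]),
      Set.indicator_of_notMem (s := R_XYXXYY) (by grind [R_XYXXYY])]
    rw [not_and_or] at hs
    rcases hs with hs | hs <;> simp [Set.indicator_apply, hs]

/-- Shuffle identity `XXYY × XY = XXYYXY + 4·XXYXYY + 9·XXXYYY + XYXXYY` for the iterated
integrals `I_λ(Σ) = ∫_Σ ∏ q(y_k) conj(q(x_k)) e^{2iλ²(y_k−x_k)}`, for Schwartz `q` and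
`Im(λ²) ≥ 0`; all integrals converge absolutely. -/
theorem shuffle_XXYY_mul_XY (q : SchwartzMap ℝ ℂ) (lam : ℂ) (hlam : 0 ≤ (lam ^ 2).im) :
    IntegrableOn (f2 ⇑q lam) R_XY volume ∧
    IntegrableOn (f4 ⇑q lam) R_XXYY volume ∧
    IntegrableOn (f6 ⇑q lam) R_XXYYXY volume ∧
    IntegrableOn (f6 ⇑q lam) R_XXYXYY volume ∧
    IntegrableOn (f6 ⇑q lam) R_XXXYYY volume ∧
    IntegrableOn (f6 ⇑q lam) R_XYXXYY volume ∧
    (∫ p in R_XXYY, f4 ⇑q lam p) * (∫ p in R_XY, f2 ⇑q lam p)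
      = (∫ p in R_XXYYXY, f6 ⇑q lam p)
        + 4 * (∫ p in R_XXYXYY, f6 ⇑q lam p)
        + 9 * (∫ p in R_XXXYYY, f6 ⇑q lam p)
        + (∫ p in R_XYXXYY, f6 ⇑q lam p) := by
  have hXY : MeasurableSet R_XY := by unfold R_XY; measurability
  have hXXYY : MeasurableSet R_XXYY := by unfold R_XXYY; measurability
  have hA : MeasurableSet R_XXYYXY := by unfold R_XXYYXY; measurability
  have hB : MeasurableSet R_XXYXYY := by unfold R_XXYXYY; measurability
  have hC : MeasurableSet R_XXXYYY := by unfold R_XXXYYY; measurability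
  have hD : MeasurableSet R_XYXXYY := by unfold R_XYXXYY; measurability
  have iA : IntegrableOn (f6 q lam) R_XXYYXY := integrableOn_f6 q hlam hA
    fun p ⟨h₁, h₂, h₃, h₄, h₅⟩ => ⟨h₁.trans h₂, h₂.trans h₃, h₅⟩
  have iB : IntegrableOn (f6 q lam) R_XXYXYY := integrableOn_f6 q hlam hB
    fun p ⟨h₁, h₂, h₃, h₄, h₅⟩ => ⟨h₁.trans h₂, h₂.trans (h₃.trans h₄), h₄.trans h₅⟩
  have iC : IntegrableOn (f6 q lam) R_XXXYYY := integrableOn_f6 q hlam hC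
    fun p ⟨h₁, h₂, h₃, h₄, h₅⟩ =>
      ⟨h₁.trans (h₂.trans h₃), h₂.trans (h₃.trans h₄), h₃.trans (h₄.trans h₅)⟩
  have iD : IntegrableOn (f6 q lam) R_XYXXYY := integrableOn_f6 q hlam hD
    fun p ⟨h₁, h₂, h₃, h₄, h₅⟩ => ⟨h₁, h₃.trans h₄, h₄.trans h₅⟩
  refine ⟨integrableOn_f2 q hlam hXY fun p h => h,
    integrableOn_f4 q hlam hXXYY fun p ⟨h₁, h₂, h₃⟩ => ⟨h₁.trans h₂, h₂.trans h₃⟩,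
    iA, iB, iC, iD, ?_⟩
  rw [← integrable_indicator_iff] at iA iB iC iD
  · rw [setIntegral_f4_mul_setIntegral_f2, integral_indicator_R_XXYY_XY q hlam, integral_add,
      integral_add, integral_add, integral_const_mul, integral_const_mul, integral_indicator hA,
      integral_indicator hB, integral_indicator hC, integral_indicator hD]
    · exact iA
    · exact iB.const_mul 4
    · exact iA.add (iB.const_mul 4)
    · exact iC.const_mul 9
    · exact (iA.add (iB.const_mul 4)).add (iC.const_mul 9)
    · exact iD
  all_goals assumption
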